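/- arXiv:1510.01597 — 2 statements merged into one kernel-verified Lean document; each statement's English description precedes it below -/
import Mathlib

section
/- Let U be any real n×n matrix and let M be a real symmetric n×n matrix. Then there exists a symmetric diagonally dominant matrix Q with M = Uᵀ Q U if and only if there exist nonnegative coefficients α_v ≥ 0, for v ∈ V_n, such that M = Σ_{v ∈ V_n} α_v · (Uᵀ v)(Uᵀ v)ᵀ. (This is the extreme-ray description of the cone DD(U).) -/
open scoped Matrix

/-- A real matrix is diagonally dominant if `A i i ≥ ∑_{j ≠ i} |A i j|` for every `i`. -/
def IsDiagDom {n : ℕ} (A : Matrix (Fin n) (Fin n) ℝ) : Prop :=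
  ∀ i, ∑ j ∈ Finset.univ.filter (fun j => j ≠ i), |A i j| ≤ A i i

/-- `v` belongs to `V_n`: `v` is a nonzero vector in `ℝⁿ` with at most 2 nonzero
components, each equal to `+1` or `-1`. -/
def MemVn {n : ℕ} (v : Fin n → ℝ) : Prop :=
  v ≠ 0 ∧ (∀ i, v i = 0 ∨ v i = 1 ∨ v i = -1) ∧
    ∃ i j : Fin n, ∀ k, k ≠ i → k ≠ j → v k = 0

theorem vn_finite (n : ℕ) : {v : Fin n → ℝ | MemVn v}.Finite := by
  have hsub : {v : Fin n → ℝ | MemVn v} ⊆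
      Set.pi Set.univ (fun _ : Fin n => ({0, 1, -1} : Set ℝ)) := by
    intro v hv i _
    rcases hv.2.1 i with h | h | h <;> simp [h]
  exact (Set.Finite.pi (fun _ : Fin n =>
    (Set.finite_singleton (-1 : ℝ)).insert 1 |>.insert 0)).subset hsub

/-- `V_n` as a finite set of vectors. -/
noncomputable def VnFinset (n : ℕ) : Finset (Fin n → ℝ) := (vn_finite n).toFinset

open scoped NNReal

theorem mem_VnFinset {n : ℕ} {v : Fin n → ℝ} : v ∈ VnFinset n ↔ MemVn v := by
  simp [VnFinset]

theorem memVn_single {n : ℕ} (i : Fin n) : MemVn (Pi.single i 1 : Fin n → ℝ) := by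
  refine ⟨by simp, fun k => ?_, i, i, fun k hk _ => by simp [hk]⟩
  by_cases h : k = i <;> simp [h]

theorem memVn_single_add_single {n : ℕ} {i j : Fin n} (hij : i ≠ j) {s : ℝ}
    (hs : s = 1 ∨ s = -1) : MemVn (Pi.single i 1 + Pi.single j s : Fin n → ℝ) := by
  refine ⟨fun h => ?_, fun k => ?_, i, j, fun k hki hkj => by simp [hki, hkj]⟩
  · simpa [hij] using congrFun h i
  · by_cases hki : k = i
    · subst hki; simp [hij]
    · by_cases hkj : k = j
      · subst hkj; simpa [hki] using Or.inr hs
      · simp [hki, hkj]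

theorem isDiagDom_vecMulVec {n : ℕ} {v : Fin n → ℝ} (hv : MemVn v) :
    IsDiagDom (Matrix.vecMulVec v v) := by
  obtain ⟨-, hv, a, b, hab⟩ := hv
  have habs : ∀ k, |v k| ≤ 1 := fun k => by rcases hv k with h | h | h <;> simp [h]
  intro i
  by_cases hi : v i = 0
  · simp [Matrix.vecMulVec_apply, hi]
  have hsq : v i * v i = 1 := by rcases hv i with h | h | h <;> simp_all
  have habs_i : |v i| = 1 := by rcases hv i with h | h | h <;> simp_all
  obtain ⟨c, hc⟩ : ∃ c, ∀ k, k ≠ i → k ≠ c → v k = 0 := by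
    by_cases hia : i = a
    · exact ⟨b, fun k hk hkb => hab k (hia ▸ hk) hkb⟩
    · have hib : i = b := by
        by_contra hib
        exact hi (hab i hia hib)
      exact ⟨a, fun k hk hka => hab k hka (hib ▸ hk)⟩
  simp only [Matrix.vecMulVec_apply, abs_mul, hsq, habs_i, one_mul]
  calc ∑ j ∈ Finset.univ.filter (fun j => j ≠ i), |v j|
      ≤ ∑ j ∈ Finset.univ.filter (fun j => j ≠ i), if j = c then (1 : ℝ) else 0 := by
        refine Finset.sum_le_sum fun j hj => ?_
        by_cases hjc : j = c
        · simpa [hjc] using habs c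
        · simp [hjc, hc j (Finset.mem_filter.1 hj).2 hjc]
    _ ≤ 1 := by
        rw [Finset.sum_ite_eq']
        split_ifs <;> norm_num

theorem IsDiagDom.add {n : ℕ} {A B : Matrix (Fin n) (Fin n) ℝ} (hA : IsDiagDom A)
    (hB : IsDiagDom B) : IsDiagDom (A + B) := fun i => by
  calc _ ≤ ∑ j ∈ Finset.univ.filter (fun j => j ≠ i), (|A i j| + |B i j|) :=
        Finset.sum_le_sum fun j _ => abs_add_le _ _
    _ ≤ _ := by
        rw [Finset.sum_add_distrib]
        exact add_le_add (hA i) (hB i)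

theorem IsDiagDom.smul {n : ℕ} {A : Matrix (Fin n) (Fin n) ℝ} (hA : IsDiagDom A) {c : ℝ}
    (hc : 0 ≤ c) : IsDiagDom (c • A) := fun i => by
  simpa [abs_mul, abs_of_nonneg hc, ← Finset.mul_sum] using mul_le_mul_of_nonneg_left (hA i) hc

theorem isDiagDom_sum {n : ℕ} {ι : Type*} (s : Finset ι) {A : ι → Matrix (Fin n) (Fin n) ℝ}
    (hA : ∀ k ∈ s, IsDiagDom (A k)) : IsDiagDom (∑ k ∈ s, A k) :=
  Finset.sum_induction A IsDiagDom (fun _ _ => IsDiagDom.add) (fun i => by simp) hA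

/-- A symmetric matrix as a combination of the matrices `vecMulVec v v` with `v ∈ V_n`; the
coefficients are nonnegative when the matrix is diagonally dominant. -/
theorem Matrix.IsSymm.eq_sum_vecMulVec {n : ℕ} {Q : Matrix (Fin n) (Fin n) ℝ} (hQ : Q.IsSymm)
    {s : Fin n → Fin n → ℝ} (hs : ∀ i j, s i j * s i j = 1)
    (hsQ : ∀ i j, |Q i j| * s i j = Q i j) :
    Q = ∑ i, ((Q i i - ∑ j ∈ Finset.univ.filter (fun j => j ≠ i), |Q i j|) •
          Matrix.vecMulVec (Pi.single i 1) (Pi.single i 1) +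
        ∑ j ∈ Finset.univ.filter (fun j => j ≠ i), (|Q i j| / 2) •
          Matrix.vecMulVec (Pi.single i 1 + Pi.single j (s i j))
            (Pi.single i 1 + Pi.single j (s i j))) := by
  set P : Fin n → Fin n → ℝ := fun i j => if j = i then 0 else Q i j with hP
  have hPsymm : ∀ i j, P i j = P j i := fun i j => by
    simp only [hP, eq_comm (a := j), hQ.apply]
  have habs : ∀ i, ∑ j ∈ Finset.univ.filter (fun j => j ≠ i), |Q i j| = ∑ j, |P i j| :=
    fun i => by
      rw [Finset.sum_filter]
      refine Finset.sum_congr rfl fun j _ => ?_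
      by_cases h : j = i <;> simp [hP, h]
  have hterm : ∀ i j a b : Fin n, (if j ≠ i then |Q i j| / 2 *
        ((Pi.single i 1 + Pi.single j (s i j) : Fin n → ℝ) a *
          (Pi.single i 1 + Pi.single j (s i j) : Fin n → ℝ) b) else 0) =
      (if a = i then if b = i then |P i j| / 2 else 0 else 0) +
      (if a = j then if b = j then |P i j| / 2 else 0 else 0) +
      (if a = i then if b = j then P i j / 2 else 0 else 0) +
      (if a = j then if b = i then P i j / 2 else 0 else 0) := fun i j a b => by
    by_cases h : j = i
    · simp [hP, h]
    · have h1 := hs i j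
      have h2 := hsQ i j
      simp only [hP, h, if_false, ne_eq, not_false_eq_true, if_true, Pi.add_apply, Pi.single_apply]
      split_ifs <;> grind
  ext a b
  simp only [habs]
  simp only [Finset.sum_filter, Matrix.sum_apply, Matrix.add_apply, Matrix.smul_apply,
    Matrix.vecMulVec_apply, smul_eq_mul, apply_ite (fun A : Matrix (Fin n) (Fin n) ℝ => A a b),
    Matrix.zero_apply, hterm, Finset.sum_add_distrib]
  have hcol : ∀ c : Fin n, ∑ i, |P i c| / 2 = (∑ j, |P c j|) / 2 := fun c => by
    rw [Finset.sum_div]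
    exact Finset.sum_congr rfl fun i _ => by rw [hPsymm]
  by_cases hab : a = b
  · subst hab
    simp [Pi.single_apply, Finset.sum_ite_irrel, hcol, ← Finset.sum_div]
    have hPa : P a a = 0 := by simp [hP]
    rw [hPa]
    ring
  · have hba : b ≠ a := Ne.symm hab
    simp [Pi.single_apply, Finset.sum_ite_irrel, hab, hba,
      ← Finset.sum_div]
    rw [hPsymm b a, add_halves]
    simp [hP, hba]

theorem IsDiagDom.mem_span {n : ℕ} {Q : Matrix (Fin n) (Fin n) ℝ} (hdd : IsDiagDom Q)
    (hQ : Q.IsSymm) :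
    Q ∈ Submodule.span ℝ≥0 ((fun v => Matrix.vecMulVec v v) '' (VnFinset n : Set (Fin n → ℝ))) := by
  have hsmul : ∀ (c : ℝ) (v : Fin n → ℝ), 0 ≤ c → MemVn v → c • Matrix.vecMulVec v v ∈
      Submodule.span ℝ≥0
        ((fun v => Matrix.vecMulVec v v) '' (VnFinset n : Set (Fin n → ℝ))) :=
    fun c v hc hv => Submodule.smul_mem _ (⟨c, hc⟩ : ℝ≥0)
      (Submodule.subset_span ⟨v, mem_VnFinset.2 hv, rfl⟩)
  rw [hQ.eq_sum_vecMulVec (s := fun i j => if 0 ≤ Q i j then 1 else -1)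
    (fun i j => by split_ifs <;> norm_num)
    (fun i j => by
      split_ifs with h
      · simp [abs_of_nonneg h]
      · simp [abs_of_neg (not_le.1 h)])]
  refine Submodule.sum_mem _ fun i _ => Submodule.add_mem _
    (hsmul _ _ (sub_nonneg.2 (hdd i)) (memVn_single i)) (Submodule.sum_mem _ fun j hj =>
      hsmul _ _ (by positivity) (memVn_single_add_single (Finset.mem_filter.1 hj).2.symm ?_))
  split_ifs <;> simp

theorem vecMulVec_transpose_mulVec {n : ℕ} (U : Matrix (Fin n) (Fin n) ℝ) (v : Fin n → ℝ) :
    Matrix.vecMulVec (Uᵀ.mulVec v) (Uᵀ.mulVec v) = Uᵀ * Matrix.vecMulVec v v * U := by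
  rw [Matrix.mul_vecMulVec, Matrix.vecMulVec_mul, Matrix.mulVec_transpose]

theorem sum_vecMulVec_transpose_mulVec {n : ℕ} (U : Matrix (Fin n) (Fin n) ℝ)
    (α : (Fin n → ℝ) → ℝ) (s : Finset (Fin n → ℝ)) :
    ∑ v ∈ s, α v • Matrix.vecMulVec (Uᵀ.mulVec v) (Uᵀ.mulVec v) =
      Uᵀ * (∑ v ∈ s, α v • Matrix.vecMulVec v v) * U := by
  simp only [vecMulVec_transpose_mulVec, Finset.mul_sum, Finset.sum_mul, Matrix.mul_smul,
    Matrix.smul_mul]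

/-- Extreme-ray description of the cone `DD(U)`: a real symmetric matrix `M` equals
`Uᵀ Q U` for some symmetric diagonally dominant `Q` if and only if `M` is a nonnegative
combination of the rank-one matrices `(Uᵀ v)(Uᵀ v)ᵀ`, `v ∈ V_n`. -/
theorem mem_DDU_iff_conic_combination {n : ℕ}
    (U M : Matrix (Fin n) (Fin n) ℝ) (hM : M.IsSymm) :
    (∃ Q : Matrix (Fin n) (Fin n) ℝ, Q.IsSymm ∧ IsDiagDom Q ∧ M = Uᵀ * Q * U) ↔
      ∃ α : (Fin n → ℝ) → ℝ, (∀ v, 0 ≤ α v) ∧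
        M = ∑ v ∈ VnFinset n, α v • Matrix.vecMulVec (Uᵀ.mulVec v) (Uᵀ.mulVec v) := by
  simp only [sum_vecMulVec_transpose_mulVec]
  constructor
  · rintro ⟨Q, hQ, hdd, rfl⟩
    obtain ⟨c, hc⟩ := (Submodule.mem_span_image_finset_iff_exists_fun' _).1 (hdd.mem_span hQ)
    exact ⟨fun v => c v, fun v => (c v).2, by rw [← hc]; rfl⟩
  · rintro ⟨α, hα, rfl⟩
    refine ⟨_, ?_, isDiagDom_sum _ fun v hv =>
      (isDiagDom_vecMulVec (mem_VnFinset.1 hv)).smul (hα v), rfl⟩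
    simp only [Matrix.IsSymm, Matrix.transpose_sum, Matrix.transpose_smul,
      Matrix.transpose_vecMulVec]
end

section
/- Let n ≥ 1 and let a₁, …, aₙ be positive integers. For ε ∈ ℝ, define the quartic form q^h_{a,ε} : ℝⁿ → ℝ by q^h_{a,ε}(x) = Σᵢ xᵢ⁴ + ((Σᵢ aᵢ xᵢ)² − 2 Σᵢ xᵢ²)·((1/n) Σᵢ xᵢ²) + (n − ε)·((1/n) Σᵢ xᵢ²)². Then the partition instance a₁, …, aₙ is infeasible (i.e., there is no subset S ⊆ {1, …, n} with Σ_{i∈S} aᵢ = Σ_{i∉S} aᵢ) if and only if there exists ε > 0 such that q^h_{a,ε}(x) ≥ 0 for all x ∈ ℝⁿ. -/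
/-- The quartic form is a sum of squares minus `ε` times the square of the mean of the `xᵢ²`. -/
theorem homog_eq_sum_sq_sub {n : ℕ} (hn : 1 ≤ n) (ℓ ε : ℝ) (x : Fin n → ℝ) :
    (∑ i, x i ^ 4) + (ℓ ^ 2 - 2 * ∑ i, x i ^ 2) * ((1 / (n : ℝ)) * ∑ i, x i ^ 2) +
        ((n : ℝ) - ε) * ((1 / (n : ℝ)) * ∑ i, x i ^ 2) ^ 2 =
      ∑ i, (x i ^ 2 - (1 / (n : ℝ)) * ∑ j, x j ^ 2) ^ 2 +
        ℓ ^ 2 * ((1 / (n : ℝ)) * ∑ i, x i ^ 2) -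
        ε * ((1 / (n : ℝ)) * ∑ i, x i ^ 2) ^ 2 := by
  have hn0 : (n : ℝ) ≠ 0 := by positivity
  obtain ⟨s, hs⟩ : ∃ s, s = (1 / (n : ℝ)) * ∑ i, x i ^ 2 := ⟨_, rfl⟩
  have hsum : ∑ i, x i ^ 2 = n * s := by rw [hs]; field_simp
  have hsq : ∑ i, (x i ^ 2 - s) ^ 2 = ∑ i, x i ^ 4 - 2 * s * ∑ i, x i ^ 2 + n * s ^ 2 := by
    have h (i : Fin n) : (x i ^ 2 - s) ^ 2 = x i ^ 4 - 2 * s * x i ^ 2 + s ^ 2 := by ring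
    simp [h, Finset.sum_add_distrib, Finset.sum_sub_distrib, Finset.mul_sum]
  rw [← hs, hsq, hsum]
  ring

/-- A sign vector orthogonal to `a` yields a balanced subset. -/
theorem exists_balanced_of_sign {n : ℕ} (a : Fin n → ℕ) (x : Fin n → ℝ)
    (hx : ∀ i, x i ^ 2 = 1) (hax : ∑ i, (a i : ℝ) * x i = 0) :
    ∃ S : Finset (Fin n), ∑ i ∈ S, a i = ∑ i ∈ Sᶜ, a i := by
  classical
  refine ⟨Finset.univ.filter fun i => x i = 1, ?_⟩
  rw [← Finset.sum_add_sum_compl (Finset.univ.filter fun i => x i = 1)] at hax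
  have h1 : ∑ i ∈ Finset.univ.filter (fun i => x i = 1), (a i : ℝ) * x i =
      ∑ i ∈ Finset.univ.filter (fun i => x i = 1), (a i : ℝ) :=
    Finset.sum_congr rfl fun i hi => by rw [(Finset.mem_filter.1 hi).2, mul_one]
  have h2 : ∑ i ∈ (Finset.univ.filter (fun i => x i = 1))ᶜ, (a i : ℝ) * x i =
      -∑ i ∈ (Finset.univ.filter (fun i => x i = 1))ᶜ, (a i : ℝ) := by
    rw [← Finset.sum_neg_distrib]
    refine Finset.sum_congr rfl fun i hi => ?_
    have hi' : x i ≠ 1 := by simpa using hi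
    rw [(by simpa using hx i : x i = 1 ∨ x i = -1).resolve_left hi', mul_neg_one]
  rw [h1, h2] at hax
  exact_mod_cast (by linarith : ∑ i ∈ Finset.univ.filter (fun i => x i = 1), (a i : ℝ) =
    ∑ i ∈ (Finset.univ.filter (fun i => x i = 1))ᶜ, (a i : ℝ))

/-- A balanced subset yields a sign vector orthogonal to `a`. -/
theorem exists_sign_of_balanced {n : ℕ} (a : Fin n → ℕ) (S : Finset (Fin n))
    (hS : ∑ i ∈ S, a i = ∑ i ∈ Sᶜ, a i) :
    ∃ x : Fin n → ℝ, (∀ i, x i ^ 2 = 1) ∧ ∑ i, (a i : ℝ) * x i = 0 := by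
  refine ⟨fun i => if i ∈ S then 1 else -1, fun i => by dsimp only; split_ifs <;> norm_num, ?_⟩
  have hS' : ∑ i ∈ S, (a i : ℝ) = ∑ i ∈ Sᶜ, (a i : ℝ) := by exact_mod_cast hS
  rw [← Finset.sum_add_sum_compl S]
  have h1 : ∑ i ∈ S, (a i : ℝ) * (if i ∈ S then 1 else -1) = ∑ i ∈ S, (a i : ℝ) :=
    Finset.sum_congr rfl fun i hi => by rw [if_pos hi, mul_one]
  have h2 : ∑ i ∈ Sᶜ, (a i : ℝ) * (if i ∈ S then 1 else -1) = -∑ i ∈ Sᶜ, (a i : ℝ) := by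
    rw [← Finset.sum_neg_distrib]
    refine Finset.sum_congr rfl fun i hi => ?_
    rw [if_neg (Finset.mem_compl.1 hi), mul_neg_one]
  rw [h1, h2, hS', add_neg_cancel]

/-- The vectors with `∑ xᵢ² = n` form a compact set. -/
theorem isCompact_setOf_sum_sq_eq (n : ℕ) :
    IsCompact {x : Fin n → ℝ | ∑ i, x i ^ 2 = n} := by
  refine Metric.isCompact_of_isClosed_isBounded
    (isClosed_eq (by fun_prop) continuous_const) ?_
  refine (Metric.isBounded_closedBall (x := (0 : Fin n → ℝ)) (r := n)).subset fun x hx => ?_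
  have hx : ∑ i, x i ^ 2 = (n : ℝ) := hx
  rw [mem_closedBall_zero_iff, pi_norm_le_iff_of_nonneg (Nat.cast_nonneg n)]
  intro i
  have hi : x i ^ 2 ≤ n :=
    hx ▸ Finset.single_le_sum (f := fun i => x i ^ 2) (fun j _ => sq_nonneg _) (Finset.mem_univ i)
  have hn : (1 : ℝ) ≤ n := by exact_mod_cast i.pos
  rw [Real.norm_eq_abs]
  exact abs_le_of_sq_le_sq (by nlinarith) (by positivity)


/-- A partition instance `a₁, …, aₙ` of positive integers is infeasible (no subset `S`
satisfies `∑_{i∈S} aᵢ = ∑_{i∉S} aᵢ`) if and only if there exists `ε > 0` such that the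
homogenized quartic form
`q^h_{a,ε}(x) = ∑ᵢ xᵢ⁴ + ((∑ᵢ aᵢ xᵢ)² − 2 ∑ᵢ xᵢ²)·((1/n) ∑ᵢ xᵢ²) + (n − ε)·((1/n) ∑ᵢ xᵢ²)²`
is nonnegative on all of `ℝⁿ`. -/
theorem partition_infeasible_iff_homog_nonneg {n : ℕ} (hn : 1 ≤ n)
    (a : Fin n → ℕ) (ha : ∀ i, 0 < a i) :
    (¬ ∃ S : Finset (Fin n), ∑ i ∈ S, a i = ∑ i ∈ Sᶜ, a i) ↔
      ∃ ε : ℝ, 0 < ε ∧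
        ∀ x : Fin n → ℝ,
          0 ≤ (∑ i, x i ^ 4) +
              ((∑ i, (a i : ℝ) * x i) ^ 2 - 2 * ∑ i, x i ^ 2) *
                ((1 / (n : ℝ)) * ∑ i, x i ^ 2) +
              ((n : ℝ) - ε) * ((1 / (n : ℝ)) * ∑ i, x i ^ 2) ^ 2 := by
  simp only [homog_eq_sum_sq_sub hn]
  have hn0 : (n : ℝ) ≠ 0 := by positivity
  constructor
  · intro hinf
    obtain ⟨y, hy, hmin⟩ := (isCompact_setOf_sum_sq_eq n).exists_isMinOn
      ⟨fun _ => 1, by simp⟩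
      (f := fun x => ∑ i, (x i ^ 2 - 1) ^ 2 + (∑ i, (a i : ℝ) * x i) ^ 2)
      (by fun_prop)
    refine ⟨∑ i, (y i ^ 2 - 1) ^ 2 + (∑ i, (a i : ℝ) * y i) ^ 2, ?_, fun x => ?_⟩
    · have h1 : 0 ≤ ∑ i, (y i ^ 2 - 1) ^ 2 := Finset.sum_nonneg fun i _ => sq_nonneg _
      have h2 := sq_nonneg (∑ i, (a i : ℝ) * y i)
      refine (add_nonneg h1 h2).lt_of_ne' fun h0 => hinf ?_
      obtain ⟨h1, h2⟩ := (add_eq_zero_iff_of_nonneg h1 h2).1 h0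
      rw [Finset.sum_eq_zero_iff_of_nonneg fun i _ => sq_nonneg _] at h1
      exact exists_balanced_of_sign a y
        (fun i => sub_eq_zero.1 (pow_eq_zero_iff two_ne_zero |>.1 (h1 i (Finset.mem_univ i))))
        (pow_eq_zero_iff two_ne_zero |>.1 h2)
    · obtain ⟨s, hs⟩ : ∃ s, s = (1 / (n : ℝ)) * ∑ i, x i ^ 2 := ⟨_, rfl⟩
      have hsum : ∑ i, x i ^ 2 = n * s := by rw [hs]; field_simp
      have hs0 : 0 ≤ s := hs ▸ by positivity
      rw [← hs]
      rcases hs0.eq_or_lt with h0 | hpos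
      · rw [← h0]
        simp only [mul_zero, add_zero, sub_zero, ne_eq, OfNat.ofNat_ne_zero, not_false_eq_true,
          zero_pow]
        positivity
      · obtain ⟨t, ht, rfl⟩ : ∃ t, 0 < t ∧ t ^ 2 = s :=
          ⟨√s, Real.sqrt_pos.2 hpos, Real.sq_sqrt hs0⟩
        have hmem : ∑ i, (x i / t) ^ 2 = (n : ℝ) := by
          simp only [div_pow, ← Finset.sum_div, hsum]
          field_simp
        have hle := isMinOn_iff.1 hmin (fun i => x i / t) hmem
        have h1 : ∑ i, (x i ^ 2 - t ^ 2) ^ 2 = t ^ 4 * ∑ i, ((x i / t) ^ 2 - 1) ^ 2 := by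
          rw [Finset.mul_sum]
          refine Finset.sum_congr rfl fun i _ => ?_
          field_simp
        have h2 : ∑ i, (a i : ℝ) * x i = t * ∑ i, (a i : ℝ) * (x i / t) := by
          rw [Finset.mul_sum]
          refine Finset.sum_congr rfl fun i _ => ?_
          field_simp
        rw [h1, h2]
        have := mul_le_mul_of_nonneg_left hle (by positivity : 0 ≤ t ^ 4)
        linarith
  · rintro ⟨ε, hε, h⟩ ⟨S, hS⟩
    obtain ⟨x, hx, hax⟩ := exists_sign_of_balanced a S hS
    have := h x
    simp [hx, hax, hn0] at this
    linarith
end
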